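/- Let a and b be square-free positive integers with gcd(a,b) ≤ 2, and let d be any square-free integer. Then the form f(x₀,y₁,y₂,y₃) = x₀² − a·y₁² − b·y₂² − a·b·y₃² properly represents d modulo 2⁴·a²·b². -/

import Mathlib

/-- `f` represents `d` modulo `m`, primitively at every prime dividing `m`. -/
def LocRep (a b d : ℤ) (m : ℕ) : Prop :=
  ∃ x y z w : ℤ, (m : ℤ) ∣ (x ^ 2 - a * y ^ 2 - b * z ^ 2 - a * b * w ^ 2 - d) ∧
    ∀ p : ℕ, p.Prime → p ∣ m → ¬ ((p : ℤ) ∣ x ∧ (p : ℤ) ∣ y ∧ (p : ℤ) ∣ z ∧ (p : ℤ) ∣ w)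

lemma LocRep.swap {a b d : ℤ} {m : ℕ} (h : LocRep a b d m) : LocRep b a d m := by
  obtain ⟨x, y, z, w, h, hp⟩ := h
  refine ⟨x, z, y, w, ?_, fun p h1 h2 h3 => hp p h1 h2 ⟨h3.1, h3.2.2.1, h3.2.1, h3.2.2.2⟩⟩
  convert h using 1; ring

lemma crt_aux {m n : ℕ} (h : m.Coprime n) (x y : ℤ) : ∃ z : ℤ, (m : ℤ) ∣ z - x ∧ (n : ℤ) ∣ z - y := by
  obtain ⟨u, v, huv⟩ := (Nat.isCoprime_iff_coprime.mpr h : IsCoprime (m : ℤ) n)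
  refine ⟨u * m * y + v * n * x, ⟨u * (y - x), ?_⟩, ⟨v * (x - y), ?_⟩⟩
  · linear_combination x * huv
  · linear_combination y * huv

lemma form_congr {a b d m x y z w x' y' z' w' : ℤ}
    (h : m ∣ (x ^ 2 - a * y ^ 2 - b * z ^ 2 - a * b * w ^ 2 - d))
    (hx : m ∣ x' - x) (hy : m ∣ y' - y) (hz : m ∣ z' - z) (hw : m ∣ w' - w) :
    m ∣ (x' ^ 2 - a * y' ^ 2 - b * z' ^ 2 - a * b * w' ^ 2 - d) := by
  obtain ⟨e, h⟩ := h
  obtain ⟨s, hx⟩ := hx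
  obtain ⟨t, hy⟩ := hy
  obtain ⟨u, hz⟩ := hz
  obtain ⟨v, hw⟩ := hw
  refine ⟨e + s * (x' + x) - a * t * (y' + y) - b * u * (z' + z) - a * b * v * (w' + w), ?_⟩
  linear_combination h + (x' + x) * hx - a * (y' + y) * hy - b * (z' + z) * hz
    - a * b * (w' + w) * hw

lemma dvd_of_sub {p m x y : ℤ} (hp : p ∣ m) (h : m ∣ x - y) (hx : p ∣ x) : p ∣ y := by
  have := dvd_sub hx (hp.trans h)
  simpa using this

lemma LocRep.mul {a b d : ℤ} {m n : ℕ} (hmn : m.Coprime n) (h1 : LocRep a b d m)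
    (h2 : LocRep a b d n) : LocRep a b d (m * n) := by
  obtain ⟨x, y, z, w, h, hp⟩ := h1
  obtain ⟨x', y', z', w', h', hp'⟩ := h2
  obtain ⟨X, hX, hX'⟩ := crt_aux hmn x x'
  obtain ⟨Y, hY, hY'⟩ := crt_aux hmn y y'
  obtain ⟨Z, hZ, hZ'⟩ := crt_aux hmn z z'
  obtain ⟨W, hW, hW'⟩ := crt_aux hmn w w'
  refine ⟨X, Y, Z, W, ?_, ?_⟩
  · push_cast
    exact IsCoprime.mul_dvd (Nat.isCoprime_iff_coprime.mpr hmn)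
      (form_congr h hX hY hZ hW) (form_congr h' hX' hY' hZ' hW')
  · rintro p pp hpm ⟨dx, dy, dz, dw⟩
    rcases (Nat.Prime.dvd_mul pp).1 hpm with hpm | hpm
    · have hc : (p : ℤ) ∣ m := by exact_mod_cast hpm
      exact hp p pp hpm ⟨dvd_of_sub hc hX dx, dvd_of_sub hc hY dy, dvd_of_sub hc hZ dz,
        dvd_of_sub hc hW dw⟩
    · have hc : (p : ℤ) ∣ n := by exact_mod_cast hpm
      exact hp' p pp hpm ⟨dvd_of_sub hc hX' dx, dvd_of_sub hc hY' dy, dvd_of_sub hc hZ' dz,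
        dvd_of_sub hc hW' dw⟩

/-- Build a prime-power local representation. -/
lemma LocRep.of_pp {a b d : ℤ} {p : ℕ} (pp : p.Prime) (k : ℕ) (x y z w : ℤ)
    (h : ((p : ℤ) ^ k) ∣ (x ^ 2 - a * y ^ 2 - b * z ^ 2 - a * b * w ^ 2 - d))
    (hn : ¬ ((p : ℤ) ∣ x ∧ (p : ℤ) ∣ y ∧ (p : ℤ) ∣ z ∧ (p : ℤ) ∣ w)) :
    LocRep a b d (p ^ k) := by
  refine ⟨x, y, z, w, by exact_mod_cast h, fun q qp hq => ?_⟩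
  have : q = p := (Nat.prime_dvd_prime_iff_eq qp pp).1 (qp.dvd_of_dvd_pow hq)
  subst this
  exact hn

lemma hensel_odd {p : ℕ} (pp : p.Prime) (hp2 : p ≠ 2) {c x e : ℤ} (hc : ¬ (p : ℤ) ∣ c)
    (hx : ¬ (p : ℤ) ∣ x) (h : (p : ℤ) ∣ c * x ^ 2 - e) (k : ℕ) :
    ∃ x' : ℤ, ¬ (p : ℤ) ∣ x' ∧ (p : ℤ) ^ (k + 1) ∣ c * x' ^ 2 - e := by
  have pz : Prime (p : ℤ) := Nat.prime_iff_prime_int.1 pp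
  induction k with
  | zero => exact ⟨x, hx, by simpa using h⟩
  | succ k ih =>
    obtain ⟨y, hy, s, hs⟩ := ih
    have h2 : ¬ (p : ℤ) ∣ 2 := by
      intro h
      have : p ∣ 2 := by exact_mod_cast h
      exact hp2 ((Nat.prime_dvd_prime_iff_eq pp Nat.prime_two).1 this)
    have hcop : IsCoprime (p : ℤ) (2 * c * y) := by
      rw [pz.coprime_iff_not_dvd]
      intro h
      rcases pz.dvd_or_dvd h with h | h
      · rcases pz.dvd_or_dvd h with h | h
        · exact h2 h
        · exact hc h
      · exact hy h
    obtain ⟨u, v, huv⟩ := hcop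
    refine ⟨y + (p : ℤ) ^ (k + 1) * (- s * v), ?_, ?_⟩
    · intro h
      apply hy
      refine (dvd_add_left ?_).1 h
      exact Dvd.dvd.mul_right (dvd_pow_self _ (by omega)) _
    · refine ⟨s * u + c * (s * v) ^ 2 * (p : ℤ) ^ k, ?_⟩
      linear_combination hs - (p : ℤ) ^ (k + 1) * s * huv

lemma binary_odd {p : ℕ} (pp : p.Prime) (hp2 : p ≠ 2) {α β e : ℤ} (hα : ¬ (p : ℤ) ∣ α)
    (hβ : ¬ (p : ℤ) ∣ β) (he : ¬ (p : ℤ) ∣ e) (k : ℕ) :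
    ∃ x y : ℤ, ¬ ((p : ℤ) ∣ x ∧ (p : ℤ) ∣ y) ∧ (p : ℤ) ^ (k + 1) ∣ α * x ^ 2 + β * y ^ 2 - e := by
  have : Fact p.Prime := ⟨pp⟩
  have hα' : (α : ZMod p) ≠ 0 := fun h => hα ((ZMod.intCast_zmod_eq_zero_iff_dvd _ _).1 h)
  have hβ' : (β : ZMod p) ≠ 0 := fun h => hβ ((ZMod.intCast_zmod_eq_zero_iff_dvd _ _).1 h)
  have key : ∃ x y : ZMod p, (α : ZMod p) * x ^ 2 + β * y ^ 2 - e = 0 := by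
    open Polynomial in
    obtain ⟨x, y, h⟩ := FiniteField.exists_root_sum_quadratic
      (f := C (α : ZMod p) * X ^ 2 + C 0 * X + C 0) (g := C (β : ZMod p) * X ^ 2 + C 0 * X + C (-(e : ZMod p)))
      (degree_quadratic hα') (degree_quadratic hβ')
      (by rw [ZMod.card]; exact pp.eq_two_or_odd.resolve_left hp2)
    refine ⟨x, y, ?_⟩
    simp at h
    linear_combination h
  obtain ⟨x, y, h⟩ := key
  obtain ⟨x, rfl⟩ := ZMod.intCast_surjective x
  obtain ⟨y, rfl⟩ := ZMod.intCast_surjective y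
  have h : (p : ℤ) ∣ α * x ^ 2 + β * y ^ 2 - e := by
    rw [← ZMod.intCast_zmod_eq_zero_iff_dvd]; push_cast; exact h
  by_cases hx : (p : ℤ) ∣ x
  · have hy : ¬ (p : ℤ) ∣ y := by
      intro hy
      apply he
      have h1 : (p : ℤ) ∣ α * x ^ 2 + β * y ^ 2 :=
        dvd_add (Dvd.dvd.mul_left (dvd_pow hx two_ne_zero) _)
          (Dvd.dvd.mul_left (dvd_pow hy two_ne_zero) _)
      simpa using dvd_sub h1 h
    obtain ⟨y', h1, h2⟩ := hensel_odd pp hp2 hβ hy (e := e - α * x ^ 2)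
      (by convert h using 1; ring) k
    exact ⟨x, y', fun h => h1 h.2, by convert h2 using 1; ring⟩
  · obtain ⟨x', h1, h2⟩ := hensel_odd pp hp2 hα hx (e := e - β * y ^ 2)
      (by convert h using 1; ring) k
    exact ⟨x', y, fun h => h1 h.1, by convert h2 using 1; ring⟩

lemma sqf_aux {p : ℕ} (pp : p.Prime) {a t : ℤ} (ha : Squarefree a) (h : a = p * t) :
    ¬ (p : ℤ) ∣ t := by
  rintro ⟨s, rfl⟩
  have := ha p ⟨s, by rw [h]; ring⟩
  exact (Nat.prime_iff_prime_int.1 pp).not_isUnit this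

lemma locRep_odd {p : ℕ} (pp : p.Prime) (hp2 : p ≠ 2) {a b d : ℤ} (ha : Squarefree a)
    (hd : Squarefree d) (hpa : (p : ℤ) ∣ a) (hpb : ¬ (p : ℤ) ∣ b) (k : ℕ) :
    LocRep a b d (p ^ (k + 1)) := by
  have pz : Prime (p : ℤ) := Nat.prime_iff_prime_int.1 pp
  by_cases hpd : (p : ℤ) ∣ d
  · obtain ⟨a', rfl⟩ := hpa
    obtain ⟨d', rfl⟩ := hpd
    have ha' := sqf_aux pp ha rfl
    have hd' := sqf_aux pp hd rfl
    obtain ⟨x, y, hn, h⟩ := binary_odd pp hp2 (α := -a') (β := -(a' * b)) (e := d')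
      (by rwa [dvd_neg]) (by
        rw [dvd_neg]; intro h
        rcases pz.dvd_or_dvd h with h | h
        · exact ha' h
        · exact hpb h) hd' k
    refine LocRep.of_pp pp _ 0 x 0 y ?_ (fun h => hn ⟨h.2.1, h.2.2.2⟩)
    have h' := Dvd.dvd.mul_left h (p : ℤ)
    have e : (0 : ℤ) ^ 2 - p * a' * x ^ 2 - b * 0 ^ 2 - p * a' * b * y ^ 2 - p * d'
        = p * (-a' * x ^ 2 + -(a' * b) * y ^ 2 - d') := by ring
    rw [e]
    exact h'
  · obtain ⟨x, y, hn, h⟩ := binary_odd pp hp2 (α := 1) (β := -b) (e := d)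
      (fun h => pz.not_isUnit (isUnit_of_dvd_one h)) (by rwa [dvd_neg]) hpd k
    refine LocRep.of_pp pp _ x 0 y 0 ?_ (fun h => hn ⟨h.1, h.2.2.1⟩)
    convert h using 1
    ring

lemma hensel_two {c e : ℤ} (hc : ¬ (2 : ℤ) ∣ c) (h : (8 : ℤ) ∣ c - e) (k : ℕ) :
    ∃ x : ℤ, ¬ (2 : ℤ) ∣ x ∧ (2 : ℤ) ^ (k + 3) ∣ c * x ^ 2 - e := by
  induction k with
  | zero => exact ⟨1, by norm_num, by simpa using h⟩
  | succ k ih =>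
    obtain ⟨y, hy, s, hs⟩ := ih
    have hcy : ∃ q, c * y = 2 * q + 1 := by
      have : Odd (c * y) := by
        rw [Int.odd_mul, ← Int.not_even_iff_odd, ← Int.not_even_iff_odd, even_iff_two_dvd,
          even_iff_two_dvd]
        exact ⟨hc, hy⟩
      exact this
    obtain ⟨q, hq⟩ := hcy
    refine ⟨y + 2 ^ (k + 2) * s, ?_, ?_⟩
    · intro h
      apply hy
      refine (dvd_add_left ?_).1 h
      exact Dvd.dvd.mul_right (dvd_pow_self _ (by omega)) _
    · refine ⟨s * (q + 1) + c * s ^ 2 * 2 ^ k, ?_⟩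
      linear_combination hs + 2 ^ (k + 3) * s * hq

lemma z8_oo : ∀ A B D : ZMod 8, 4 * A ≠ 0 → 4 * B ≠ 0 → 2 * D ≠ 0 →
    (∃ y z w : ZMod 8, 1 - A * y ^ 2 - B * z ^ 2 - A * B * w ^ 2 = D) ∨
    (∃ x z w : ZMod 8, x ^ 2 - A - B * z ^ 2 - A * B * w ^ 2 = D) := by
  decide +kernel

set_option synthInstance.maxHeartbeats 400000 in
set_option synthInstance.maxSize 2000 in
lemma z8_eo : ∀ A B D : ZMod 8, 4 * A ≠ 0 → 2 * B ≠ 0 → 4 * D ≠ 0 →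
    (∃ y z w : ZMod 8, 1 - 2 * A * y ^ 2 - B * z ^ 2 - 2 * A * B * w ^ 2 = D) := by
  decide +kernel

lemma z8_e1 : ∀ A B D : ZMod 8, 4 * A ≠ 0 → 4 * B ≠ 0 → 4 * D ≠ 0 →
    (∃ x z w : ZMod 8, 2 * x ^ 2 - A - 2 * B * z ^ 2 - A * B * w ^ 2 = D) := by
  decide +kernel

lemma z8_e2 : ∀ A B D : ZMod 8, 4 * A ≠ 0 → 4 * B ≠ 0 → 4 * D ≠ 0 →
    (∃ x z w : ZMod 8, 2 * x ^ 2 - A - B * z ^ 2 - 2 * A * B * w ^ 2 = D) := by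
  decide +kernel

lemma cast8 {t : ℤ} (ht : ¬ (2 : ℤ) ∣ t) : 4 * (t : ZMod 8) ≠ 0 := by
  intro h
  have : ((4 * t : ℤ) : ZMod 8) = 0 := by push_cast; exact h
  have := (ZMod.intCast_zmod_eq_zero_iff_dvd _ 8).1 this
  push_cast at this
  omega

lemma cast8' {t : ℤ} (ht : ¬ (4 : ℤ) ∣ t) : 2 * (t : ZMod 8) ≠ 0 := by
  intro h
  have : ((2 * t : ℤ) : ZMod 8) = 0 := by push_cast; exact h
  have := (ZMod.intCast_zmod_eq_zero_iff_dvd _ 8).1 this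
  push_cast at this
  omega

lemma dvd8 {t : ℤ} (h : (t : ZMod 8) = 0) : (8 : ℤ) ∣ t := by
  have := (ZMod.intCast_zmod_eq_zero_iff_dvd _ 8).1 h
  exact_mod_cast this

lemma pow_weaken {k : ℕ} {t : ℤ} (h : (2 : ℤ) ^ (k + 3) ∣ t) : (((2 : ℕ) : ℤ)) ^ k ∣ t :=
  (pow_dvd_pow _ (by omega)).trans h

lemma rep_even_two {a b d : ℤ} (ha : ¬ (4 : ℤ) ∣ a) (hb : ¬ (4 : ℤ) ∣ b) (hd : ¬ (4 : ℤ) ∣ d)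
    (h2 : (2 : ℤ) ∣ a) (k : ℕ) : LocRep a b d (2 ^ k) := by
  obtain ⟨A, rfl⟩ := h2
  have hA : ¬ (2 : ℤ) ∣ A := by omega
  by_cases hd2 : (2 : ℤ) ∣ d
  · obtain ⟨D, rfl⟩ := hd2
    have hD : ¬ (2 : ℤ) ∣ D := by omega
    by_cases hb2 : (2 : ℤ) ∣ b
    · obtain ⟨B, rfl⟩ := hb2
      have hB : ¬ (2 : ℤ) ∣ B := by omega
      obtain ⟨x, z, w, h⟩ := z8_e2 A B D (cast8 hA) (cast8 hB) (cast8 hD)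
      obtain ⟨x, rfl⟩ := ZMod.intCast_surjective x
      obtain ⟨z, rfl⟩ := ZMod.intCast_surjective z
      obtain ⟨w, rfl⟩ := ZMod.intCast_surjective w
      obtain ⟨y, hy, h⟩ := hensel_two (c := -A) (e := D - 2 * x ^ 2 + B * z ^ 2 + 2 * A * B * w ^ 2)
        (by rwa [dvd_neg]) (dvd8 (by push_cast; linear_combination h)) k
      refine LocRep.of_pp Nat.prime_two k (2 * x) y z w ?_ (fun h => hy (by exact_mod_cast h.2.1))
      obtain ⟨s, hs⟩ := pow_weaken h
      exact ⟨2 * s, by linear_combination 2 * hs⟩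
    · obtain ⟨x, z, w, h⟩ := z8_e1 A b D (cast8 hA) (cast8 hb2) (cast8 hD)
      obtain ⟨x, rfl⟩ := ZMod.intCast_surjective x
      obtain ⟨z, rfl⟩ := ZMod.intCast_surjective z
      obtain ⟨w, rfl⟩ := ZMod.intCast_surjective w
      obtain ⟨y, hy, h⟩ := hensel_two (c := -A) (e := D - 2 * x ^ 2 + 2 * b * z ^ 2 + A * b * w ^ 2)
        (by rwa [dvd_neg]) (dvd8 (by push_cast; linear_combination h)) k
      refine LocRep.of_pp Nat.prime_two k (2 * x) y (2 * z) w ?_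
        (fun h => hy (by exact_mod_cast h.2.1))
      obtain ⟨s, hs⟩ := pow_weaken h
      exact ⟨2 * s, by linear_combination 2 * hs⟩
  · obtain ⟨y, z, w, h⟩ := z8_eo A b d (cast8 hA) (cast8' hb) (cast8 hd2)
    obtain ⟨y, rfl⟩ := ZMod.intCast_surjective y
    obtain ⟨z, rfl⟩ := ZMod.intCast_surjective z
    obtain ⟨w, rfl⟩ := ZMod.intCast_surjective w
    obtain ⟨x, hx, h⟩ := hensel_two (c := 1) (e := d + 2 * A * y ^ 2 + b * z ^ 2 + 2 * A * b * w ^ 2)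
      (by norm_num) (dvd8 (by push_cast; linear_combination h)) k
    refine LocRep.of_pp Nat.prime_two k x y z w ?_ (fun h => hx (by exact_mod_cast h.1))
    convert (pow_weaken h) using 1
    ring

lemma locRep_two {a b d : ℤ} (ha : ¬ (4 : ℤ) ∣ a) (hb : ¬ (4 : ℤ) ∣ b) (hd : ¬ (4 : ℤ) ∣ d)
    (k : ℕ) : LocRep a b d (2 ^ k) := by
  by_cases ha2 : (2 : ℤ) ∣ a
  · exact rep_even_two ha hb hd ha2 k
  by_cases hb2 : (2 : ℤ) ∣ b
  · exact (rep_even_two hb ha hd hb2 k).swap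
  rcases z8_oo a b d (cast8 ha2) (cast8 hb2) (cast8' hd) with ⟨y, z, w, h⟩ | ⟨x, z, w, h⟩
  · obtain ⟨y, rfl⟩ := ZMod.intCast_surjective y
    obtain ⟨z, rfl⟩ := ZMod.intCast_surjective z
    obtain ⟨w, rfl⟩ := ZMod.intCast_surjective w
    obtain ⟨x, hx, h⟩ := hensel_two (c := 1) (e := d + a * y ^ 2 + b * z ^ 2 + a * b * w ^ 2)
      (by norm_num) (dvd8 (by push_cast; linear_combination h)) k
    refine LocRep.of_pp Nat.prime_two k x y z w ?_ (fun h => hx (by exact_mod_cast h.1))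
    convert (pow_weaken h) using 1
    ring
  · obtain ⟨x, rfl⟩ := ZMod.intCast_surjective x
    obtain ⟨z, rfl⟩ := ZMod.intCast_surjective z
    obtain ⟨w, rfl⟩ := ZMod.intCast_surjective w
    obtain ⟨y, hy, h⟩ := hensel_two (c := -a) (e := d - x ^ 2 + b * z ^ 2 + a * b * w ^ 2)
      (by rwa [dvd_neg]) (dvd8 (by push_cast; linear_combination h)) k
    refine LocRep.of_pp Nat.prime_two k x y z w ?_ (fun h => hy (by exact_mod_cast h.2.1))
    convert (pow_weaken h) using 1
    ring

lemma sqf_four {a : ℤ} (ha : Squarefree a) : ¬ (4 : ℤ) ∣ a := by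
  intro h
  have := ha 2 (by norm_num; exact h)
  exact Int.prime_two.not_isUnit this

lemma locRep_all {a b d : ℤ} (ha : Squarefree a) (hb : Squarefree b) (hd : Squarefree d)
    (hgcd : Int.gcd a b ≤ 2) (m : ℕ)
    (hm : ∀ p : ℕ, p.Prime → p ∣ m → (p : ℤ) ∣ 2 * a * b) (hm0 : m ≠ 0) : LocRep a b d m := by
  induction m using Nat.recOnPosPrimePosCoprime with
  | zero => exact absurd rfl hm0
  | one =>
    refine ⟨0, 0, 0, 0, by simp, fun p pp h => ?_⟩
    exact absurd (Nat.dvd_one.1 h) pp.ne_one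
  | prime_pow p n pp hn =>
    by_cases hp2 : p = 2
    · subst hp2
      exact locRep_two (sqf_four ha) (sqf_four hb) (sqf_four hd) n
    · obtain ⟨k, rfl⟩ : ∃ k, n = k + 1 := ⟨n - 1, by omega⟩
      have pz : Prime (p : ℤ) := Nat.prime_iff_prime_int.1 pp
      have hnb : ¬ ((p : ℤ) ∣ a ∧ (p : ℤ) ∣ b) := by
        rintro ⟨h1, h2⟩
        have h3 : p ∣ Int.gcd a b := by
          have := Int.dvd_coe_gcd h1 h2
          exact_mod_cast this
        have h4 := Nat.le_of_dvd (Int.gcd_pos_of_ne_zero_left _ ha.ne_zero) h3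
        have := pp.two_le
        omega
      have h := hm p pp (dvd_pow_self p (by omega))
      rcases pz.dvd_or_dvd h with h | h
      · rcases pz.dvd_or_dvd h with h | h
        · exfalso
          have : p ∣ 2 := by exact_mod_cast h
          exact hp2 ((Nat.prime_dvd_prime_iff_eq pp Nat.prime_two).1 this)
        · exact locRep_odd pp hp2 ha hd h (fun h' => hnb ⟨h, h'⟩) k
      · exact (locRep_odd pp hp2 hb hd h (fun h' => hnb ⟨h', h⟩) k).swap
  | coprime m n hm1 hn1 hmn ihm ihn =>
    exact (ihm (fun p pp h => hm p pp (h.mul_right _)) (by omega)).mul hmn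
      (ihn (fun p pp h => hm p pp (h.mul_left _)) (by omega))

/-- Adjusting within a residue class to become coprime to `g`. -/
lemma adjust {N : ℕ} (hN : N ≠ 0) {g : ℕ} (hg : g ≠ 0) (x : ℤ)
    (h : ∀ p : ℕ, p.Prime → p ∣ N → ¬ ((p : ℤ) ∣ x ∧ p ∣ g)) :
    ∃ x' : ℤ, (N : ℤ) ∣ x' - x ∧ IsCoprime x' (g : ℤ) := by
  set q : ℕ := Int.gcd x N with hq
  have hqpos : 0 < q := Int.gcd_pos_of_ne_zero_right _ (by exact_mod_cast hN)
  obtain ⟨y, hy⟩ : (q : ℤ) ∣ x := Int.gcd_dvd_left ..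
  obtain ⟨M, hM⟩ : q ∣ N := by
    have : (q : ℤ) ∣ N := Int.gcd_dvd_right ..
    exact_mod_cast this
  have hcop : IsCoprime y (M : ℤ) := by
    obtain ⟨u, v, huv⟩ : ∃ u v : ℤ, (q : ℤ) = x * u + N * v := ⟨_, _, Int.gcd_eq_gcd_ab x N⟩
    refine ⟨u, v, ?_⟩
    have hq0 : (q : ℤ) ≠ 0 := by exact_mod_cast hqpos.ne'
    apply mul_left_cancel₀ hq0
    have hM' : (N : ℤ) = q * M := by exact_mod_cast hM
    linear_combination -huv - u * hy - v * hM'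
  have hqg : Nat.Coprime q g := by
    apply Nat.coprime_of_dvd
    intro p pp h1 h2
    refine h p pp (h1.trans ⟨M, hM⟩) ⟨?_, h2⟩
    exact (by exact_mod_cast h1 : (p : ℤ) ∣ q).trans ⟨y, hy⟩
  have hM0 : M ≠ 0 := by rintro rfl; simp at hM; exact hN hM
  have : NeZero (M * g) := ⟨mul_ne_zero hM0 hg⟩
  have hu : IsUnit (y : ZMod M) := by
    obtain ⟨u, v, huv⟩ := hcop
    refine IsUnit.of_mul_eq_one (u : ZMod M) ?_
    have := congrArg (Int.cast : ℤ → ZMod M) huv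
    push_cast at this
    simp at this
    rw [mul_comm]; exact this
  obtain ⟨t, ht⟩ := ZMod.unitsMap_surjective (Dvd.intro g rfl : M ∣ M * g) hu.unit
  obtain ⟨z, hz⟩ := ZMod.intCast_surjective (t : ZMod (M * g))
  have hz1 : (M : ℤ) ∣ z - y := by
    rw [← ZMod.intCast_zmod_eq_zero_iff_dvd]
    have h1 := congrArg Units.val ht
    rw [ZMod.unitsMap_val, ← hz] at h1
    simp at h1
    push_cast
    rw [h1, sub_self]
  have hz2 : IsCoprime z (g : ℤ) := by
    have h1 : ((z * ((t⁻¹ : (ZMod (M * g))ˣ) : ZMod (M * g)).val - 1 : ℤ) : ZMod (M * g)) = 0 := by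
      push_cast
      rw [hz, ZMod.natCast_zmod_val]; simp
    obtain ⟨c, hc⟩ := (ZMod.intCast_zmod_eq_zero_iff_dvd _ _).1 h1
    push_cast at hc
    refine ⟨(((t⁻¹ : (ZMod (M * g))ˣ) : ZMod (M * g)).val : ℤ), -(M * c), ?_⟩
    linear_combination hc
  refine ⟨q * z, ?_, ?_⟩
  · obtain ⟨c, hc⟩ := hz1
    refine ⟨c, ?_⟩
    have hM' : (N : ℤ) = q * M := by exact_mod_cast hM
    rw [hM']
    linear_combination q * hc - hy
  · exact IsCoprime.mul_left (Nat.isCoprime_iff_coprime.mpr hqg) hz2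

theorem stmt_11 (a b : ℤ) (ha : Squarefree a) (hb : Squarefree b)
    (hapos : 0 < a) (hbpos : 0 < b) (hgcd : Int.gcd a b ≤ 2)
    (d : ℤ) (hd : Squarefree d) :
    ∃ r₀ r₁ r₂ r₃ : ℤ, Int.gcd r₀ (Int.gcd r₁ (Int.gcd r₂ r₃)) = 1 ∧
      r₀ ^ 2 - a * r₁ ^ 2 - b * r₂ ^ 2 - a * b * r₃ ^ 2 ≡ d
        [ZMOD 2 ^ 4 * a ^ 2 * b ^ 2] := by
  obtain ⟨N, hN⟩ := Int.eq_ofNat_of_zero_le (a := 2 ^ 4 * a ^ 2 * b ^ 2) (by positivity)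
  have hN0 : N ≠ 0 := by
    rintro rfl
    have : 0 < 2 ^ 4 * a ^ 2 * b ^ 2 := by positivity
    rw [hN] at this
    simp at this
  obtain ⟨x, y, z, w, h, hp⟩ := locRep_all ha hb hd hgcd N (by
    intro p pp hpN
    have pz : Prime (p : ℤ) := Nat.prime_iff_prime_int.1 pp
    have h1 : (p : ℤ) ∣ N := by exact_mod_cast hpN
    rw [← hN] at h1
    have h2 : (p : ℤ) ∣ (2 * a * b) ^ 4 := h1.trans ⟨a ^ 2 * b ^ 2, by ring⟩
    exact pz.dvd_of_dvd_pow h2) hN0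
  -- make the second coordinate nonzero
  obtain ⟨y', hy', hy0⟩ : ∃ y' : ℤ, (N : ℤ) ∣ y' - y ∧ y' ≠ 0 := by
    by_cases hy : y = 0
    · exact ⟨N, by simp [hy], by exact_mod_cast hN0⟩
    · exact ⟨y, by simp, hy⟩
  obtain ⟨x', hx', hc⟩ := adjust hN0 (g := Int.gcd y' (Int.gcd z w))
    (Int.gcd_pos_of_ne_zero_left _ hy0).ne' x (by
      rintro p pp hpN ⟨h1, h2⟩
      have hpN' : (p : ℤ) ∣ N := by exact_mod_cast hpN
      have h2' : (p : ℤ) ∣ (Int.gcd y' (Int.gcd z w) : ℤ) := by exact_mod_cast h2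
      have h3 := h2'.trans (Int.gcd_dvd_left ..)
      have h4 := h2'.trans (Int.gcd_dvd_right ..)
      exact hp p pp hpN ⟨h1, dvd_of_sub hpN' hy' h3, h4.trans (Int.gcd_dvd_left ..),
        h4.trans (Int.gcd_dvd_right ..)⟩)
  refine ⟨x', y', z, w, Int.isCoprime_iff_gcd_eq_one.1 hc, ?_⟩
  rw [hN]
  exact (Int.modEq_iff_dvd.2 (form_congr h hx' hy' (by simp) (by simp))).symm
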